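/- arXiv:2310.14182 — 9 statements merged into one kernel-verified Lean document; each statement's English description precedes it below -/
import Mathlib

section
/- Let E be a real inner product space (for a complex space such as ℂ^N the real inner product ⟨x,z⟩ = Re(xᴴz) is used), let A ⊆ E be an atomic set symmetric with respect to the origin (a ∈ A implies −a ∈ A), let y ∈ E and ζ > 0. Then a point x* ∈ E with finite atomic norm minimizes the AST objective g(x) = ‖x‖_A + (ζ/2)‖y − x‖² over all x ∈ E with finite atomic norm if and only if both of the following hold: (i) ⟨y − x*, a⟩ ≤ ζ⁻¹ for every a ∈ A, and (ii) ⟨x*, y − x*⟩ = ζ⁻¹ ‖x*‖_A. -/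
open scoped RealInnerProductSpace BigOperators

variable {E : Type*} [NormedAddCommGroup E] [InnerProductSpace ℝ E]

/-- The set of values `∑ i, c i` over all finite conic decompositions
`x = ∑ i, c i • a i` with `c i > 0` and `a i ∈ A`. -/
def decompSums (A : Set E) (x : E) : Set ℝ :=
  { s | ∃ (L : ℕ) (c : Fin L → ℝ) (a : Fin L → E),
      (∀ i, 0 < c i) ∧ (∀ i, a i ∈ A) ∧ x = ∑ i, c i • a i ∧ s = ∑ i, c i }

/-- The atomic norm of `x` w.r.t. the atomic set `A` (as a real infimum; `x` has
finite atomic norm iff `decompSums A x` is nonempty). -/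
noncomputable def atomicNorm (A : Set E) (x : E) : ℝ := sInf (decompSums A x)

/-- The AST objective `g(x) = ‖x‖_A + (ζ/2)‖y − x‖²`. -/
noncomputable def astObj (A : Set E) (ζ : ℝ) (y x : E) : ℝ :=
  atomicNorm A x + ζ / 2 * ‖y - x‖ ^ 2

/-- The mixed-integer AST objective of a finite family `((c i, a i))_{i < L}`. -/
noncomputable def mixedObj (ζ : ℝ) (y : E) {L : ℕ} (c : Fin L → ℝ) (a : Fin L → E) : ℝ :=
  (∑ i, c i) + ζ / 2 * ‖y - ∑ i, c i • a i‖ ^ 2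

/-- A finite family is a global solution of the mixed-integer AST problem if its
objective is at most that of every admissible finite family. -/
def IsGlobalSolution (A : Set E) (ζ : ℝ) (y : E) {L : ℕ}
    (c : Fin L → ℝ) (a : Fin L → E) : Prop :=
  ∀ (L' : ℕ) (c' : Fin L' → ℝ) (a' : Fin L' → E),
    (∀ i, 0 ≤ c' i) → (∀ i, a' i ∈ A) → mixedObj ζ y c a ≤ mixedObj ζ y c' a'

lemma decompSums_nonneg {A : Set E} {x : E} {s : ℝ} (hs : s ∈ decompSums A x) : 0 ≤ s := by
  obtain ⟨L, c, a, hc, -, -, rfl⟩ := hs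
  exact Finset.sum_nonneg fun i _ => (hc i).le

lemma atomicNorm_le {A : Set E} {x : E} {s : ℝ} (hs : s ∈ decompSums A x) :
    atomicNorm A x ≤ s :=
  csInf_le ⟨0, fun _ h => decompSums_nonneg h⟩ hs

lemma add_mem_decompSums {A : Set E} {x a : E} {s t : ℝ} (hs : s ∈ decompSums A x)
    (ha : a ∈ A) (ht : 0 < t) : t + s ∈ decompSums A (x + t • a) := by
  obtain ⟨L, c, b, hc, hb, rfl, rfl⟩ := hs
  refine ⟨L + 1, Fin.cons t c, Fin.cons a b, ?_, ?_, ?_, ?_⟩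
  · exact Fin.cases (by simpa using ht) (by simpa using hc)
  · exact Fin.cases (by simpa using ha) (by simpa using hb)
  · simp [Fin.sum_univ_succ, add_comm]
  · simp [Fin.sum_univ_succ]

lemma smul_mem_decompSums {A : Set E} {x : E} {s t : ℝ} (hs : s ∈ decompSums A x)
    (ht : 0 < t) : t * s ∈ decompSums A (t • x) := by
  obtain ⟨L, c, b, hc, hb, rfl, rfl⟩ := hs
  exact ⟨L, fun i => t * c i, b, fun i => mul_pos ht (hc i), hb,
    by simp [Finset.smul_sum, mul_smul], by simp [Finset.mul_sum]⟩

lemma atomicNorm_add_smul_le {A : Set E} {x a : E} {t : ℝ} (hx : (decompSums A x).Nonempty)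
    (ha : a ∈ A) (ht : 0 < t) : atomicNorm A (x + t • a) ≤ t + atomicNorm A x := by
  have h : atomicNorm A (x + t • a) - t ≤ atomicNorm A x :=
    le_csInf hx fun s hs => by linarith [atomicNorm_le (add_mem_decompSums hs ha ht)]
  linarith

lemma atomicNorm_smul_le {A : Set E} {x : E} {t : ℝ} (hx : (decompSums A x).Nonempty)
    (ht : 0 < t) : atomicNorm A (t • x) ≤ t * atomicNorm A x := by
  have h : atomicNorm A (t • x) / t ≤ atomicNorm A x :=
    le_csInf hx fun s hs => by
      rw [div_le_iff₀' ht]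
      exact atomicNorm_le (smul_mem_decompSums hs ht)
  rwa [div_le_iff₀' ht] at h

lemma inner_le_mul_atomicNorm {A : Set E} {x r : E} {k : ℝ} (hx : (decompSums A x).Nonempty)
    (hk : 0 < k) (hr : ∀ a ∈ A, ⟪r, a⟫ ≤ k) : ⟪r, x⟫ ≤ k * atomicNorm A x := by
  rw [← div_le_iff₀' hk]
  refine le_csInf hx ?_
  rintro s ⟨L, c, a, hc, ha, rfl, rfl⟩
  rw [div_le_iff₀' hk, inner_sum, Finset.mul_sum]
  refine Finset.sum_le_sum fun i _ => ?_
  rw [real_inner_smul_right, mul_comm k]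
  exact mul_le_mul_of_nonneg_left (hr _ (ha i)) (hc i).le

lemma norm_sub_add_sq (y x d : E) :
    ‖y - (x + d)‖ ^ 2 = ‖y - x‖ ^ 2 - 2 * ⟪y - x, d⟫ + ‖d‖ ^ 2 := by
  rw [← sub_sub, norm_sub_sq_real]

lemma nonneg_of_forall_small {p q : ℝ} (h : ∀ t, 0 < t → t < 1 → 0 ≤ t * p + t ^ 2 * q) :
    0 ≤ p := by
  have hlim : Filter.Tendsto (fun t : ℝ => p + t * q) (nhdsWithin 0 (Set.Ioi 0)) (nhds p) := by
    have hc : Continuous fun t : ℝ => p + t * q := by fun_prop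
    simpa using (hc.tendsto 0).mono_left nhdsWithin_le_nhds
  refine ge_of_tendsto hlim ?_
  filter_upwards [Ioo_mem_nhdsGT (zero_lt_one' ℝ)] with t ht
  refine nonneg_of_mul_nonneg_right ?_ ht.1
  linarith [h t ht.1 ht.2]

theorem stmt0 (A : Set E) (hA : ∀ a ∈ A, -a ∈ A) (y : E) (ζ : ℝ) (hζ : 0 < ζ)
    (xstar : E) (hx : (decompSums A xstar).Nonempty) :
    (∀ x : E, (decompSums A x).Nonempty → astObj A ζ y xstar ≤ astObj A ζ y x) ↔
      ((∀ a ∈ A, ⟪y - xstar, a⟫ ≤ ζ⁻¹) ∧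
        ⟪xstar, y - xstar⟫ = ζ⁻¹ * atomicNorm A xstar) := by
  constructor
  · intro hmin
    have hscale (t : ℝ) (ht : 0 < 1 + t) :
        0 ≤ t * (atomicNorm A xstar - ζ * ⟪y - xstar, xstar⟫) +
          t ^ 2 * (ζ / 2 * ‖xstar‖ ^ 2) := by
      obtain ⟨s, hs⟩ := hx
      have h := hmin _ ⟨_, smul_mem_decompSums hs ht⟩
      have hN := atomicNorm_smul_le ⟨s, hs⟩ ht
      have hn := norm_sub_add_sq y xstar (t • xstar)
      rw [real_inner_smul_right, norm_smul, mul_pow, Real.norm_eq_abs, sq_abs] at hn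
      unfold astObj at h
      rw [add_smul, one_smul] at h hN
      rw [hn] at h
      linarith
    constructor
    · intro a ha
      have hp : 0 ≤ 1 - ζ * ⟪y - xstar, a⟫ := by
        refine nonneg_of_forall_small (q := ζ / 2 * ‖a‖ ^ 2) fun t ht _ => ?_
        obtain ⟨s, hs⟩ := hx
        have h := hmin _ ⟨_, add_mem_decompSums hs ha ht⟩
        have hN := atomicNorm_add_smul_le ⟨s, hs⟩ ha ht
        have hn := norm_sub_add_sq y xstar (t • a)
        rw [real_inner_smul_right, norm_smul, mul_pow, Real.norm_eq_abs, sq_abs] at hn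
        unfold astObj at h
        rw [hn] at h
        linarith
      rw [← one_div, le_div_iff₀' hζ]
      linarith
    · have h₁ : 0 ≤ atomicNorm A xstar - ζ * ⟪y - xstar, xstar⟫ :=
        nonneg_of_forall_small fun t ht _ => hscale t (by linarith)
      have h₂ : 0 ≤ -(atomicNorm A xstar - ζ * ⟪y - xstar, xstar⟫) :=
        nonneg_of_forall_small (q := ζ / 2 * ‖xstar‖ ^ 2) fun t _ ht => by
          linarith [hscale (-t) (by linarith)]
      rw [real_inner_comm, eq_inv_mul_iff_mul_eq₀ hζ.ne']
      linarith
  · rintro ⟨hdual, heq⟩ x hx'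
    have h := inner_le_mul_atomicNorm hx' (inv_pos.2 hζ) hdual
    rw [le_inv_mul_iff₀ hζ] at h
    rw [real_inner_comm, eq_inv_mul_iff_mul_eq₀ hζ.ne'] at heq
    have hn := norm_sub_add_sq y xstar (x - xstar)
    rw [add_sub_cancel, inner_sub_right] at hn
    unfold astObj
    rw [hn]
    have hq : 0 ≤ ζ / 2 * ‖x - xstar‖ ^ 2 := by positivity
    linarith
end

section
/- Let E be a real inner product space, A ⊆ E a nonempty atomic set, ζ > 0, and x ∈ E. Define f(x, A, ζ) = inf_{c ≥ 0, a ∈ A} [ (ζ/2)‖x − c a‖² + c ]. Then f(x, A, ζ) ≤ (ζ/2)‖x‖² always, and f(x, A, ζ) = (ζ/2)‖x‖² if and only if ⟨x, a⟩ ≤ ζ⁻¹ for every a ∈ A. -/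
open scoped RealInnerProductSpace BigOperators

variable {E : Type*} [NormedAddCommGroup E] [InnerProductSpace ℝ E]

/-- The single-atom shrinkage-and-thresholding value
`f(x, A, ζ) = inf_{c ≥ 0, a ∈ A} (ζ/2)‖x − c a‖² + c`. -/
noncomputable def fval (A : Set E) (ζ : ℝ) (x : E) : ℝ :=
  sInf { v | ∃ (c : ℝ) (a : E), 0 ≤ c ∧ a ∈ A ∧ v = ζ / 2 * ‖x - c • a‖ ^ 2 + c }

theorem half_mul_norm_sub_smul_sq_add (ζ c : ℝ) (x a : E) :
    ζ / 2 * ‖x - c • a‖ ^ 2 + c =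
      ζ / 2 * ‖x‖ ^ 2 - c * (ζ * ⟪x, a⟫ - 1) + ζ / 2 * c ^ 2 * ‖a‖ ^ 2 := by
  rw [norm_sub_sq_real, inner_smul_right, norm_smul, mul_pow, Real.norm_eq_abs, sq_abs]
  ring

theorem fval_le {A : Set E} {ζ c : ℝ} (hζ : 0 < ζ) (x : E) {a : E} (hc : 0 ≤ c) (ha : a ∈ A) :
    fval A ζ x ≤ ζ / 2 * ‖x - c • a‖ ^ 2 + c := by
  refine csInf_le ⟨0, ?_⟩ ⟨c, a, hc, ha, rfl⟩
  rintro v ⟨d, b, hd, -, rfl⟩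
  positivity

theorem stmt1 (A : Set E) (hA : A.Nonempty) (ζ : ℝ) (hζ : 0 < ζ) (x : E) :
    fval A ζ x ≤ ζ / 2 * ‖x‖ ^ 2 ∧
      (fval A ζ x = ζ / 2 * ‖x‖ ^ 2 ↔ ∀ a ∈ A, ⟪x, a⟫ ≤ ζ⁻¹) := by
  obtain ⟨a₀, ha₀⟩ := hA
  have hle : fval A ζ x ≤ ζ / 2 * ‖x‖ ^ 2 := by
    simpa using fval_le hζ x le_rfl ha₀
  refine ⟨hle, fun heq a ha => ?_, fun h => le_antisymm hle ?_⟩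
  · by_contra! hlt
    have hd : 0 < ζ * ⟪x, a⟫ - 1 := by
      have := (inv_lt_iff_one_lt_mul₀' hζ).1 hlt
      linarith
    set d := ζ * ⟪x, a⟫ - 1 with hd_def
    set c := d / (ζ * (‖a‖ ^ 2 + 1)) with hc_def
    have hc : 0 < c := by positivity
    have hcd : c * (ζ * (‖a‖ ^ 2 + 1)) = d := div_mul_cancel₀ _ (by positivity)
    have hval := fval_le hζ x hc.le ha
    rw [heq, half_mul_norm_sub_smul_sq_add, ← hd_def] at hval
    have hsq : ζ * c ^ 2 * ‖a‖ ^ 2 = c * d - ζ * c ^ 2 := by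
      rw [← hcd]
      ring
    have h₁ : 0 < c * d := mul_pos hc hd
    have h₂ : 0 < ζ * c ^ 2 := by positivity
    linarith
  · refine le_csInf ⟨_, 0, a₀, le_rfl, ha₀, rfl⟩ ?_
    rintro v ⟨c, a, hc, ha, rfl⟩
    have hd : ζ * ⟪x, a⟫ - 1 ≤ 0 := by
      have := (le_inv_mul_iff₀ hζ).1 ((h a ha).trans_eq (mul_one _).symm)
      linarith
    rw [half_mul_norm_sub_smul_sq_add]
    have h₁ : c * (ζ * ⟪x, a⟫ - 1) ≤ 0 := mul_nonpos_of_nonneg_of_nonpos hc hd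
    have h₂ : 0 ≤ ζ / 2 * c ^ 2 * ‖a‖ ^ 2 := by positivity
    linarith
end

section
/- Let E be a real inner product space, A ⊆ E an atomic set symmetric with respect to the origin, y ∈ E and ζ > 0. Suppose the finite family S = ((c_1, a_1), …, (c_L, a_L)) with c_i > 0 and a_i ∈ A is a global solution of the mixed-integer AST problem, i.e., h(S) ≤ h(S') for every finite family S' of pairs (c, a) with c ≥ 0 and a ∈ A. Then the residual y_r = y − Σ_{i=1}^L c_i a_i satisfies ⟨y_r, a⟩ ≤ ζ⁻¹ for every a ∈ A. -/
open scoped RealInnerProductSpace BigOperators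

variable {E : Type*} [NormedAddCommGroup E] [InnerProductSpace ℝ E]

/-- Prepending the pair `(t, b)` to a finite family changes the mixed-integer AST objective by a
quadratic polynomial in `t`. -/
theorem mixedObj_cons (ζ : ℝ) (y : E) {L : ℕ} (c : Fin L → ℝ) (a : Fin L → E) (t : ℝ) (b : E) :
    mixedObj ζ y (Fin.cons t c : Fin (L + 1) → ℝ) (Fin.cons b a : Fin (L + 1) → E) =
      mixedObj ζ y c a + t - ζ * t * ⟪y - ∑ i, c i • a i, b⟫ + ζ / 2 * t ^ 2 * ‖b‖ ^ 2 := by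
  simp only [mixedObj, Fin.sum_univ_succ, Fin.cons_zero, Fin.cons_succ]
  rw [add_comm (t • b), ← sub_sub, norm_sub_sq_real, inner_smul_right, norm_smul, mul_pow,
    Real.norm_eq_abs, sq_abs]
  ring

theorem stmt2 (A : Set E) (hA : ∀ a ∈ A, -a ∈ A) (y : E) (ζ : ℝ) (hζ : 0 < ζ)
    {L : ℕ} (c : Fin L → ℝ) (a : Fin L → E) (hc : ∀ i, 0 < c i) (ha : ∀ i, a i ∈ A)
    (hopt : IsGlobalSolution A ζ y c a) :
    ∀ b ∈ A, ⟪y - ∑ i, c i • a i, b⟫ ≤ ζ⁻¹ := by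
  intro b hb
  by_contra! hlt
  have hpos : 0 < ζ * ⟪y - ∑ i, c i • a i, b⟫ - 1 := by
    rw [sub_pos, mul_comm]
    exact (inv_lt_iff_one_lt_mul₀ hζ).mp hlt
  set δ := ζ * ⟪y - ∑ i, c i • a i, b⟫ - 1 with hδ
  have hden : 0 < ζ * ‖b‖ ^ 2 + 1 := by positivity
  obtain ⟨t, ht⟩ : ∃ t, t = δ / (ζ * ‖b‖ ^ 2 + 1) := ⟨_, rfl⟩
  have htpos : 0 < t := ht ▸ div_pos hpos hden
  have hδt : t * (ζ * ‖b‖ ^ 2 + 1) = δ := by rw [ht, div_mul_cancel₀ _ hden.ne']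
  have hle := hopt (L + 1) (Fin.cons t c) (Fin.cons b a)
    (Fin.forall_fin_succ.mpr ⟨htpos.le, fun i => (hc i).le⟩)
    (Fin.forall_fin_succ.mpr ⟨hb, ha⟩)
  rw [mixedObj_cons] at hle
  have hquad : t * δ ≤ ζ / 2 * t ^ 2 * ‖b‖ ^ 2 := by
    rw [hδ]
    linarith
  rw [← hδt] at hquad
  have hnonneg : 0 ≤ ζ * t ^ 2 * ‖b‖ ^ 2 := by positivity
  nlinarith [pow_pos htpos 2]
end

section
/- Let E be a real inner product space, A ⊆ E an atomic set symmetric with respect to the origin, y ∈ E and ζ > 0. Suppose the finite family S = ((c_1, a_1), …, (c_L, a_L)) with c_i > 0 and a_i ∈ A is a global solution of the mixed-integer AST problem, and let y_r = y − Σ_{i=1}^L c_i a_i. Then for every index i, ⟨a_i, y_r⟩ = ζ⁻¹. -/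
open scoped RealInnerProductSpace BigOperators

variable {E : Type*} [NormedAddCommGroup E] [InnerProductSpace ℝ E]

/-- Changing the coefficient of one atom by `t` changes the objective by a quadratic in `t`. -/
theorem mixedObj_add_single (ζ : ℝ) (y : E) {L : ℕ} (c : Fin L → ℝ) (a : Fin L → E)
    (i : Fin L) (t : ℝ) :
    mixedObj ζ y (c + Pi.single i t) a =
      mixedObj ζ y c a + (t * (1 - ζ * ⟪a i, y - ∑ j, c j • a j⟫)
        + t ^ 2 * (ζ / 2 * ‖a i‖ ^ 2)) := by
  have hsum : ∑ j, (c + Pi.single i t : Fin L → ℝ) j • a j = (∑ j, c j • a j) + t • a i := by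
    simp [add_smul, Finset.sum_add_distrib, Pi.single_apply, ite_smul]
  have hcoef : ∑ j, (c + Pi.single i t : Fin L → ℝ) j = (∑ j, c j) + t := by
    simp [Finset.sum_add_distrib]
  rw [mixedObj, mixedObj, hsum, hcoef, ← sub_sub, norm_sub_sq_real, real_inner_smul_right,
    norm_smul, real_inner_comm, mul_pow, Real.norm_eq_abs, sq_abs]
  ring

/-- A quadratic without constant term that is nonnegative near `0` has no linear term. -/
theorem linear_coeff_eq_zero_of_eventually_nonneg {p k : ℝ}
    (h : ∀ᶠ t in nhds (0 : ℝ), 0 ≤ t * p + t ^ 2 * k) : p = 0 := by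
  have hmin : IsLocalMin (fun t : ℝ => t * p + t ^ 2 * k) 0 := by
    filter_upwards [h] with t ht
    simpa using ht
  have hderiv : HasDerivAt (fun t : ℝ => t * p + t ^ 2 * k) p 0 := by
    refine (((hasDerivAt_id' (0 : ℝ)).mul_const p).fun_add
      (((hasDerivAt_id' (0 : ℝ)).fun_pow 2).mul_const k)).congr_deriv ?_
    simp
  exact hmin.hasDerivAt_eq_zero hderiv

theorem stmt3 (A : Set E) (hA : ∀ a ∈ A, -a ∈ A) (y : E) (ζ : ℝ) (hζ : 0 < ζ)
    {L : ℕ} (c : Fin L → ℝ) (a : Fin L → E) (hc : ∀ i, 0 < c i) (ha : ∀ i, a i ∈ A)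
    (hopt : IsGlobalSolution A ζ y c a) :
    ∀ i : Fin L, ⟪a i, y - ∑ j, c j • a j⟫ = ζ⁻¹ := by
  intro i
  have hlin : 1 - ζ * ⟪a i, y - ∑ j, c j • a j⟫ = 0 := by
    apply linear_coeff_eq_zero_of_eventually_nonneg (k := ζ / 2 * ‖a i‖ ^ 2)
    filter_upwards [lt_mem_nhds (neg_lt_zero.mpr (hc i))] with t ht
    have hnonneg : ∀ j, 0 ≤ (c + Pi.single i t : Fin L → ℝ) j := by
      intro j
      rcases eq_or_ne j i with rfl | hj
      · simp only [Pi.add_apply, Pi.single_eq_same]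
        linarith
      · simpa [hj] using (hc j).le
    have hle := hopt L (c + Pi.single i t) a hnonneg ha
    rw [mixedObj_add_single] at hle
    linarith
  exact eq_inv_of_mul_eq_one_right (sub_eq_zero.mp hlin).symm
end

section
/- Let E be a real inner product space, A ⊆ E an atomic set symmetric with respect to the origin, y ∈ E and ζ > 0. Suppose the finite family S = ((c_1, a_1), …, (c_L, a_L)) with c_i > 0 and a_i ∈ A is a global solution of the mixed-integer AST problem. Then x = Σ_{i=1}^L c_i a_i minimizes the AST objective g(x') = ‖x'‖_A + (ζ/2)‖y − x'‖² over all x' ∈ E with finite atomic norm, and moreover ‖x‖_A = Σ_{i=1}^L c_i. -/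
open scoped RealInnerProductSpace BigOperators

variable {E : Type*} [NormedAddCommGroup E] [InnerProductSpace ℝ E]

/-- Every conic decomposition of `x` is an admissible family for the mixed-integer problem. -/
theorem IsGlobalSolution.le_add_of_mem_decompSums {A : Set E} {ζ : ℝ} {y : E} {L : ℕ}
    {c : Fin L → ℝ} {a : Fin L → E} (hopt : IsGlobalSolution A ζ y c a) {x : E} {s : ℝ}
    (hs : s ∈ decompSums A x) : mixedObj ζ y c a ≤ s + ζ / 2 * ‖y - x‖ ^ 2 := by
  obtain ⟨L', c', a', hc', ha', rfl, rfl⟩ := hs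
  exact hopt L' c' a' (fun i => (hc' i).le) ha'

theorem stmt4 (A : Set E) (hA : ∀ a ∈ A, -a ∈ A) (y : E) (ζ : ℝ) (hζ : 0 < ζ)
    {L : ℕ} (c : Fin L → ℝ) (a : Fin L → E) (hc : ∀ i, 0 < c i) (ha : ∀ i, a i ∈ A)
    (hopt : IsGlobalSolution A ζ y c a) :
    (∀ x : E, (decompSums A x).Nonempty →
        astObj A ζ y (∑ i, c i • a i) ≤ astObj A ζ y x) ∧
      atomicNorm A (∑ i, c i • a i) = ∑ i, c i := by
  have hnorm : atomicNorm A (∑ i, c i • a i) = ∑ i, c i := by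
    refine IsLeast.csInf_eq ⟨⟨L, c, a, hc, ha, rfl, rfl⟩, fun s hs => ?_⟩
    have h := hopt.le_add_of_mem_decompSums hs
    unfold mixedObj at h
    linarith
  refine ⟨fun x hx => ?_, hnorm⟩
  have h : mixedObj ζ y c a - ζ / 2 * ‖y - x‖ ^ 2 ≤ atomicNorm A x :=
    le_csInf hx fun s hs => sub_le_iff_le_add.mpr (hopt.le_add_of_mem_decompSums hs)
  unfold mixedObj at h
  unfold astObj
  rw [hnorm]
  linarith
end

section
/- Let E be a real inner product space, A ⊆ E an atomic set symmetric with respect to the origin, y ∈ E and ζ > 0. A finite family S = ((c_1, a_1), …, (c_L, a_L)) with c_i > 0 and a_i ∈ A is a global solution of the mixed-integer AST problem (i.e., h(S) ≤ h(S') for every finite family S') if and only if both of the following hold for y_r = y − Σ_{i=1}^L c_i a_i: (i) ⟨y_r, a⟩ ≤ ζ⁻¹ for every a ∈ A, and (ii) ⟨Σ_{i=1}^L c_i a_i, y_r⟩ = ζ⁻¹ Σ_{i=1}^L c_i. -/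
open scoped RealInnerProductSpace BigOperators

variable {E : Type*} [NormedAddCommGroup E] [InnerProductSpace ℝ E]

/-- If `0 ≤ t * p + t ^ 2 * q` for all small positive `t`, then `p ≥ 0`. -/
theorem nonneg_of_forall_mul_add_sq_mul_nonneg {p q : ℝ}
    (h : ∀ t : ℝ, 0 < t → t ≤ 1 → 0 ≤ t * p + t ^ 2 * q) : 0 ≤ p := by
  by_contra! hp
  have hd : 0 < |q| - p := by linarith [abs_nonneg q]
  have ht : 0 < -p / (2 * (|q| - p)) := div_pos (by linarith) (by linarith)
  have ht1 : -p / (2 * (|q| - p)) ≤ 1 := by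
    rw [div_le_one (by linarith)]
    linarith [abs_nonneg q]
  have h1 := h _ ht ht1
  set t := -p / (2 * (|q| - p)) with htdef
  have hmul : t * (2 * (|q| - p)) = -p := by
    rw [htdef]
    field_simp
  have h2 : 0 ≤ t * (p + t * q) := by linarith [h1]
  have h3 : 0 ≤ p + t * q := nonneg_of_mul_nonneg_right h2 ht
  have h4 : t * q ≤ t * |q| := mul_le_mul_of_nonneg_left (le_abs_self q) ht.le
  have h5 : 0 < t * -p := mul_pos ht (by linarith)
  linarith

theorem stmt6 (A : Set E) (hA : ∀ a ∈ A, -a ∈ A) (y : E) (ζ : ℝ) (hζ : 0 < ζ)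
    {L : ℕ} (c : Fin L → ℝ) (a : Fin L → E) (hc : ∀ i, 0 < c i) (ha : ∀ i, a i ∈ A) :
    IsGlobalSolution A ζ y c a ↔
      ((∀ b ∈ A, ⟪y - ∑ i, c i • a i, b⟫ ≤ ζ⁻¹) ∧
        ⟪∑ i, c i • a i, y - ∑ i, c i • a i⟫ = ζ⁻¹ * ∑ i, c i) := by
  have hζi : ζ * ζ⁻¹ = 1 := mul_inv_cancel₀ hζ.ne'
  have expand : ∀ (t : ℝ) (r v : E),
      ‖r - t • v‖ ^ 2 = ‖r‖ ^ 2 - 2 * (t * ⟪r, v⟫) + t ^ 2 * ‖v‖ ^ 2 := by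
    intro t r v
    rw [norm_sub_sq_real, real_inner_smul_right, norm_smul, mul_pow, Real.norm_eq_abs, sq_abs]
  constructor
  · intro h
    have scale : ∀ s : ℝ, -1 ≤ s → 0 ≤ s * (∑ i, c i)
        - ζ * (s * ⟪y - ∑ i, c i • a i, ∑ i, c i • a i⟫)
        + s ^ 2 * (ζ / 2 * ‖∑ i, c i • a i‖ ^ 2) := by
      intro s hs
      have h1 := h L (fun i => (1 + s) * c i) a
        (fun i => mul_nonneg (by linarith) (hc i).le) ha
      simp only [mixedObj, mul_smul, ← Finset.mul_sum, ← Finset.smul_sum] at h1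
      rw [add_smul, one_smul, ← sub_sub, expand] at h1
      linarith
    refine ⟨fun b hb => ?_, ?_⟩
    · have key : 0 ≤ 1 - ζ * ⟪y - ∑ i, c i • a i, b⟫ := by
        refine nonneg_of_forall_mul_add_sq_mul_nonneg (q := ζ / 2 * ‖b‖ ^ 2) fun t ht _ => ?_
        have h1 := h (L + 1) (Fin.cons t c) (Fin.cons b a)
          (Fin.cases ht.le fun i => (hc i).le) (Fin.cases hb ha)
        simp only [mixedObj, Fin.sum_univ_succ, Fin.cons_zero, Fin.cons_succ] at h1
        rw [add_comm (t • b), ← sub_sub, expand] at h1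
        linarith
      rw [← one_div, le_div_iff₀' hζ]
      linarith
    · have hle : 0 ≤ (∑ i, c i) - ζ * ⟪y - ∑ i, c i • a i, ∑ i, c i • a i⟫ :=
        nonneg_of_forall_mul_add_sq_mul_nonneg (q := ζ / 2 * ‖∑ i, c i • a i‖ ^ 2) fun t ht _ => by
          linarith [scale t (by linarith)]
      have hge : 0 ≤ -((∑ i, c i) - ζ * ⟪y - ∑ i, c i • a i, ∑ i, c i • a i⟫) :=
        nonneg_of_forall_mul_add_sq_mul_nonneg (q := ζ / 2 * ‖∑ i, c i • a i‖ ^ 2) fun t ht ht1 => by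
          linarith [scale (-t) (by linarith)]
      rw [real_inner_comm, eq_inv_mul_iff_mul_eq₀ hζ.ne']
      linarith
  · rintro ⟨h1, h2⟩ L' c' a' hc' ha'
    have hx : ζ * ⟪y - ∑ i, c i • a i, ∑ i, c i • a i⟫ = ∑ i, c i := by
      rw [real_inner_comm, h2, ← mul_assoc, hζi, one_mul]
    have hx' : ζ * ⟪y - ∑ i, c i • a i, ∑ i, c' i • a' i⟫ ≤ ∑ i, c' i := by
      rw [inner_sum, Finset.mul_sum]
      refine Finset.sum_le_sum fun i _ => ?_
      rw [real_inner_smul_right]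
      calc ζ * (c' i * ⟪y - ∑ i, c i • a i, a' i⟫) ≤ ζ * (c' i * ζ⁻¹) := by
            gcongr
            · exact hc' i
            · exact h1 _ (ha' i)
        _ = c' i := by rw [mul_left_comm, hζi, mul_one]
    have hnorm := expand 1 (y - ∑ i, c i • a i) (∑ i, c' i • a' i - ∑ i, c i • a i)
    rw [one_smul, sub_sub_sub_cancel_right, inner_sub_right] at hnorm
    have hpos : 0 ≤ ζ / 2 * ‖∑ i, c' i • a' i - ∑ i, c i • a i‖ ^ 2 := by positivity
    simp only [mixedObj]
    rw [hnorm]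
    linarith
end

section
/- Let E be a real inner product space, A ⊆ E an atomic set symmetric with respect to the origin, and ζ > 0. Let c_1, …, c_L > 0 and a_1, …, a_L ∈ A, set x = Σ_{i=1}^L c_i a_i, and suppose there exists z ∈ E such that ⟨z, a⟩ ≤ ζ⁻¹ for every a ∈ A and ⟨z, x⟩ = ζ⁻¹ Σ_{i=1}^L c_i. Then ‖x‖_A = Σ_{i=1}^L c_i. -/
open scoped RealInnerProductSpace BigOperators

variable {E : Type*} [NormedAddCommGroup E] [InnerProductSpace ℝ E]

/-- A linear functional bounded by `r` on the atoms is bounded by `r * s` at every point admitting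
a conic decomposition of total weight `s`. -/
theorem inner_le_mul_of_mem_decompSums {A : Set E} {x z : E} {r s : ℝ}
    (hz : ∀ b ∈ A, ⟪z, b⟫ ≤ r) (hs : s ∈ decompSums A x) : ⟪z, x⟫ ≤ r * s := by
  obtain ⟨L, c, a, hc, ha, rfl, rfl⟩ := hs
  simp only [inner_sum, real_inner_smul_right, Finset.mul_sum]
  refine Finset.sum_le_sum fun i _ => ?_
  rw [mul_comm r]
  exact mul_le_mul_of_nonneg_left (hz _ (ha i)) (hc i).le

theorem stmt7 (A : Set E) (hA : ∀ a ∈ A, -a ∈ A) (ζ : ℝ) (hζ : 0 < ζ)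
    {L : ℕ} (c : Fin L → ℝ) (a : Fin L → E) (hc : ∀ i, 0 < c i) (ha : ∀ i, a i ∈ A)
    (z : E) (hz1 : ∀ b ∈ A, ⟪z, b⟫ ≤ ζ⁻¹)
    (hz2 : ⟪z, ∑ i, c i • a i⟫ = ζ⁻¹ * ∑ i, c i) :
    atomicNorm A (∑ i, c i • a i) = ∑ i, c i := by
  have hmin : IsLeast (decompSums A (∑ i, c i • a i)) (∑ i, c i) :=
    ⟨⟨L, c, a, hc, ha, rfl, rfl⟩, fun s hs => le_of_mul_le_mul_left
      (hz2 ▸ inner_le_mul_of_mem_decompSums hz1 hs) (inv_pos.mpr hζ)⟩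
  exact hmin.csInf_eq
end

section
/- Let E be a real inner product space, A ⊆ E an atomic set, y ∈ E and ζ > 0 (weak duality for AST). If z ∈ E satisfies the dual feasibility condition ⟨z, a⟩ ≤ ζ⁻¹ for every a ∈ A, then for every x ∈ E with finite atomic norm, ζ⟨z, y⟩ − (ζ/2)‖z‖² ≤ ‖x‖_A + (ζ/2)‖y − x‖². -/
open scoped RealInnerProductSpace BigOperators

variable {E : Type*} [NormedAddCommGroup E] [InnerProductSpace ℝ E]

/-- A dual feasible vector pairs with `x` to at most `ζ⁻¹` times the atomic norm of `x`. -/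
theorem mul_inner_le_atomicNorm {A : Set E} {ζ : ℝ} (hζ : 0 < ζ) {z : E}
    (hz : ∀ a ∈ A, ⟪z, a⟫ ≤ ζ⁻¹) {x : E} (hx : (decompSums A x).Nonempty) :
    ζ * ⟪z, x⟫ ≤ atomicNorm A x := by
  refine le_csInf hx ?_
  rintro s ⟨L, c, a, hc, ha, rfl, rfl⟩
  rw [inner_sum, Finset.mul_sum]
  refine Finset.sum_le_sum fun i _ => ?_
  have h : ζ * ⟪z, a i⟫ ≤ 1 := by
    simpa [hζ.ne'] using mul_le_mul_of_nonneg_left (hz _ (ha i)) hζ.le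
  rw [real_inner_smul_right]
  nlinarith [hc i]

theorem stmt9 (A : Set E) (y : E) (ζ : ℝ) (hζ : 0 < ζ) (z : E)
    (hz : ∀ a ∈ A, ⟪z, a⟫ ≤ ζ⁻¹) (x : E) (hx : (decompSums A x).Nonempty) :
    ζ * ⟪z, y⟫ - ζ / 2 * ‖z‖ ^ 2 ≤ atomicNorm A x + ζ / 2 * ‖y - x‖ ^ 2 := by
  have h := mul_inner_le_atomicNorm hζ hz hx
  have hsq := norm_sub_sq_real z (y - x)
  rw [inner_sub_right] at hsq
  nlinarith [mul_nonneg hζ.le (sq_nonneg ‖z - (y - x)‖)]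
end

section
/- Let E be a real inner product space, A ⊆ E an atomic set with 0 ∉ A (every atom is nonzero), y_r ∈ E and ζ > 0. Suppose a* ∈ A maximizes the function a ↦ (⟨y_r, a⟩ − ζ⁻¹)/‖a‖ over A, and define c* = 0 if ⟨y_r, a*⟩ ≤ ζ⁻¹ and c* = (⟨y_r, a*⟩ − ζ⁻¹)/‖a*‖² otherwise. Then for every c ≥ 0 and every a ∈ A, (ζ/2)‖y_r − c* a*‖² + c* ≤ (ζ/2)‖y_r − c a‖² + c; that is, (c*, a*) attains the infimum of the single-atom shrinkage-and-thresholding problem. -/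
open scoped RealInnerProductSpace BigOperators

variable {E : Type*} [NormedAddCommGroup E] [InnerProductSpace ℝ E]

/-- The single-atom objective depends on `(c, a)` only through the length `c * ‖a‖` and the
normalized shrunken correlation `(⟪y, a⟫ - ζ⁻¹) / ‖a‖`. -/
theorem single_atom_objective_eq {F : Type*} [NormedAddCommGroup F] [InnerProductSpace ℝ F]
    {ζ : ℝ} (hζ : ζ ≠ 0) (y : F) (c : ℝ) {a : F} (ha : a ≠ 0) :
    ζ / 2 * ‖y - c • a‖ ^ 2 + c =
      ζ / 2 * (‖y‖ ^ 2 - 2 * (c * ‖a‖) * ((⟪y, a⟫ - ζ⁻¹) / ‖a‖) + (c * ‖a‖) ^ 2) := by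
  have hn : ‖a‖ ≠ 0 := norm_ne_zero_iff.mpr ha
  rw [norm_sub_sq_real, real_inner_smul_right, norm_smul, mul_pow, Real.norm_eq_abs, sq_abs]
  field_simp
  ring

theorem stmt12 (A : Set E) (hA0 : (0 : E) ∉ A) (yr : E) (ζ : ℝ) (hζ : 0 < ζ)
    (astar : E) (hastar : astar ∈ A)
    (hmax : ∀ a ∈ A, (⟪yr, a⟫ - ζ⁻¹) / ‖a‖ ≤ (⟪yr, astar⟫ - ζ⁻¹) / ‖astar‖)
    (cstar : ℝ)
    (hcstar : cstar =
      if ⟪yr, astar⟫ ≤ ζ⁻¹ then 0 else (⟪yr, astar⟫ - ζ⁻¹) / ‖astar‖ ^ 2) :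
    ∀ c : ℝ, 0 ≤ c → ∀ a ∈ A,
      ζ / 2 * ‖yr - cstar • astar‖ ^ 2 + cstar ≤ ζ / 2 * ‖yr - c • a‖ ^ 2 + c := by
  intro c hc a ha
  have ha0 : a ≠ 0 := ne_of_mem_of_not_mem ha hA0
  have hs0 : astar ≠ 0 := ne_of_mem_of_not_mem hastar hA0
  have hn : 0 < ‖astar‖ := norm_pos_iff.mpr hs0
  have hu : 0 ≤ c * ‖a‖ := mul_nonneg hc (norm_nonneg a)
  have hut := mul_le_mul_of_nonneg_left (hmax a ha) hu
  rw [single_atom_objective_eq hζ.ne' yr cstar hs0, single_atom_objective_eq hζ.ne' yr c ha0]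
  refine mul_le_mul_of_nonneg_left ?_ (by positivity)
  split_ifs at hcstar with h
  · have hs : (⟪yr, astar⟫ - ζ⁻¹) / ‖astar‖ ≤ 0 :=
      div_nonpos_of_nonpos_of_nonneg (sub_nonpos.mpr h) hn.le
    have hus := mul_nonpos_of_nonneg_of_nonpos hu hs
    rw [hcstar]
    nlinarith [sq_nonneg (c * ‖a‖)]
  · have hcs : cstar * ‖astar‖ = (⟪yr, astar⟫ - ζ⁻¹) / ‖astar‖ := by
      rw [hcstar]
      field_simp
    rw [hcs]
    nlinarith [sq_nonneg (c * ‖a‖ - (⟪yr, astar⟫ - ζ⁻¹) / ‖astar‖)]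
end
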